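/- Let ν > 0 and let u ∈ C²(ℝ², ℝ²) and π ∈ C¹(ℝ², ℝ) satisfy the stationary Navier–Stokes equations −νΔu + (u·∇)u + ∇π = 0 and div u = 0 on all of ℝ². If sup_{ℝ²} |u| < ∞, then u is a constant vector. -/

import Mathlib

noncomputable section

open MeasureTheory Real Filter

/-- Partial derivative ∂ₖu(x) ∈ ℝⁿ of a vector field u : ℝⁿ → ℝⁿ. -/
def pd {n : ℕ} (u : EuclideanSpace ℝ (Fin n) → EuclideanSpace ℝ (Fin n))
    (k : Fin n) (x : EuclideanSpace ℝ (Fin n)) : EuclideanSpace ℝ (Fin n) :=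
  fderiv ℝ u x (EuclideanSpace.single k 1)

/-- Divergence of u at x. -/
def divg {n : ℕ} (u : EuclideanSpace ℝ (Fin n) → EuclideanSpace ℝ (Fin n))
    (x : EuclideanSpace ℝ (Fin n)) : ℝ :=
  ∑ k, pd u k x k

/-- Symmetric gradient ε(u)(x) = (1/2)(∇u + (∇u)ᵀ), entry (i,j) = (∂ⱼuⁱ + ∂ᵢuʲ)/2. -/
def symGrad {n : ℕ} (u : EuclideanSpace ℝ (Fin n) → EuclideanSpace ℝ (Fin n))
    (x : EuclideanSpace ℝ (Fin n)) : Matrix (Fin n) (Fin n) ℝ :=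
  fun i j => (pd u j x i + pd u i x j) / 2

/-- Full gradient ∇u(x), entry (i,j) = ∂ⱼuⁱ. -/
def gradM {n : ℕ} (u : EuclideanSpace ℝ (Fin n) → EuclideanSpace ℝ (Fin n))
    (x : EuclideanSpace ℝ (Fin n)) : Matrix (Fin n) (Fin n) ℝ :=
  fun i j => pd u j x i

/-- Frobenius inner product A : B. -/
def frob {n : ℕ} (A B : Matrix (Fin n) (Fin n) ℝ) : ℝ := ∑ i, ∑ j, A i j * B i j

/-- Frobenius norm |A|. -/
def fnorm {n : ℕ} (A : Matrix (Fin n) (Fin n) ℝ) : ℝ := Real.sqrt (frob A A)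

/-- DH(ε) = (h'(|ε|)/|ε|) ε, interpreted as 0 at ε = 0. -/
def DH {n : ℕ} (h : ℝ → ℝ) (A : Matrix (Fin n) (Fin n) ℝ) : Matrix (Fin n) (Fin n) ℝ :=
  if fnorm A = 0 then 0 else (deriv h (fnorm A) / fnorm A) • A

/-- u is a weak solution of -div DH(ε(u)) + (u·∇)u + ∇π = 0, div u = 0:
for all smooth compactly supported divergence-free φ,
∫ DH(ε(u)) : ε(φ) dx + ∫ uᵏ ∂ₖuⁱ φⁱ dx = 0. -/
def IsWeakSolution {n : ℕ} (h : ℝ → ℝ)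
    (u : EuclideanSpace ℝ (Fin n) → EuclideanSpace ℝ (Fin n)) : Prop :=
  ∀ φ : EuclideanSpace ℝ (Fin n) → EuclideanSpace ℝ (Fin n),
    ContDiff ℝ (⊤ : ℕ∞) φ → HasCompactSupport φ → (∀ x, divg φ x = 0) →
    (∫ x, frob (DH h (symGrad u x)) (symGrad φ x)) +
      (∫ x, ∑ k, ∑ i, u x k * pd u k x i * φ x i) = 0

/-- u is a weak solution of the Stokes-type system -div DH(ε(u)) + ∇π = 0, div u = 0:
for all smooth compactly supported divergence-free φ, ∫ DH(ε(u)) : ε(φ) dx = 0. -/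
def IsStokesWeakSolution {n : ℕ} (h : ℝ → ℝ)
    (u : EuclideanSpace ℝ (Fin n) → EuclideanSpace ℝ (Fin n)) : Prop :=
  ∀ φ : EuclideanSpace ℝ (Fin n) → EuclideanSpace ℝ (Fin n),
    ContDiff ℝ (⊤ : ℕ∞) φ → HasCompactSupport φ → (∀ x, divg φ x = 0) →
    (∫ x, frob (DH h (symGrad u x)) (symGrad φ x)) = 0

/-- The open square Q_R(x₀) ⊂ ℝ². -/
def sqr (R : ℝ) (x₀ : EuclideanSpace ℝ (Fin 2)) : Set (EuclideanSpace ℝ (Fin 2)) :=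
  {x | |x 0 - x₀ 0| < R ∧ |x 1 - x₀ 1| < R}

/-- h'(t)/t, extended by h''(0) at t = 0. -/
def slopeH (h : ℝ → ℝ) (t : ℝ) : ℝ :=
  if t = 0 then deriv (deriv h) 0 else deriv h t / t


/-! ### Polar coordinates -/

def nsP (z : ℂ) (r θ : ℝ) : ℂ := z + r • (cos θ • (1 : ℂ) + sin θ • Complex.I)

def nsDx (f : ℂ → ℝ) (z : ℂ) : ℝ := fderiv ℝ f z 1

def nsDy (f : ℂ → ℝ) (z : ℂ) : ℝ := fderiv ℝ f z Complex.I

lemma nsP_cont (z : ℂ) : Continuous (fun p : ℝ × ℝ => nsP z p.1 p.2) := by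
  unfold nsP
  fun_prop

lemma nsP_cont_right (z : ℂ) (r : ℝ) : Continuous (fun θ : ℝ => nsP z r θ) := by
  unfold nsP
  fun_prop

lemma nsP_zero (z : ℂ) (θ : ℝ) : nsP z 0 θ = z := by
  simp [nsP]

lemma nsP_dist (z : ℂ) {r : ℝ} (hr : 0 ≤ r) (θ : ℝ) : dist (nsP z r θ) z = r := by
  rw [nsP, dist_eq_norm, add_sub_cancel_left, norm_smul, Real.norm_of_nonneg hr]
  have : ‖cos θ • (1 : ℂ) + sin θ • Complex.I‖ = 1 := by
    have h := Complex.norm_exp_ofReal_mul_I θ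
    rw [Complex.exp_mul_I] at h
    simp only [Complex.real_smul, mul_one, Complex.ofReal_cos, Complex.ofReal_sin]
    exact h
  rw [this, mul_one]

lemma nsP_period (z : ℂ) (r : ℝ) : nsP z r (2 * π) = nsP z r 0 := by
  simp [nsP]

lemma nsDx_cont {f : ℂ → ℝ} (hf : ContDiff ℝ 1 f) : Continuous (nsDx f) := by
  unfold nsDx
  exact (hf.continuous_fderiv (by norm_num)).clm_apply continuous_const

lemma nsDy_cont {f : ℂ → ℝ} (hf : ContDiff ℝ 1 f) : Continuous (nsDy f) := by
  unfold nsDy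
  exact (hf.continuous_fderiv (by norm_num)).clm_apply continuous_const

lemma ns_deriv_r {f : ℂ → ℝ} (hf : ContDiff ℝ 1 f) (z : ℂ) (r θ : ℝ) :
    HasDerivAt (fun r => f (nsP z r θ))
      (cos θ * nsDx f (nsP z r θ) + sin θ * nsDy f (nsP z r θ)) r := by
  have h1 : HasDerivAt (fun r : ℝ => nsP z r θ) (cos θ • (1 : ℂ) + sin θ • Complex.I) r := by
    unfold nsP
    simpa only [id, one_smul] using
      ((hasDerivAt_id r).smul_const (cos θ • (1 : ℂ) + sin θ • Complex.I)).const_add z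
  have h2 : HasFDerivAt f (fderiv ℝ f (nsP z r θ)) (nsP z r θ) :=
    ((hf.differentiable (by norm_num)) _).hasFDerivAt
  have h3 := h2.comp_hasDerivAt r h1
  rw [map_add, map_smul, map_smul] at h3
  exact h3

lemma ns_deriv_θ {f : ℂ → ℝ} (hf : ContDiff ℝ 1 f) (z : ℂ) (r θ : ℝ) :
    HasDerivAt (fun θ => f (nsP z r θ))
      (r * (cos θ * nsDy f (nsP z r θ) - sin θ * nsDx f (nsP z r θ))) θ := by
  have h1 : HasDerivAt (fun θ : ℝ => nsP z r θ)
      (r • ((-sin θ) • (1 : ℂ) + cos θ • Complex.I)) θ := by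
    unfold nsP
    exact ((((hasDerivAt_cos θ).smul_const (1 : ℂ)).add
      ((hasDerivAt_sin θ).smul_const Complex.I)).const_smul r).const_add z
  have h2 : HasFDerivAt f (fderiv ℝ f (nsP z r θ)) (nsP z r θ) :=
    ((hf.differentiable (by norm_num)) _).hasFDerivAt
  have h3 := h2.comp_hasDerivAt θ h1
  rw [map_smul, map_add, map_smul, map_smul] at h3
  refine h3.congr_deriv ?_
  simp only [smul_eq_mul, nsDx, nsDy]
  ring

lemma ns_param (F F' : ℝ → ℝ → ℝ) (hF : Continuous (fun p : ℝ × ℝ => F p.1 p.2))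
    (hF' : Continuous (fun p : ℝ × ℝ => F' p.1 p.2))
    (hd : ∀ r θ, HasDerivAt (fun r => F r θ) (F' r θ) r) (r₀ : ℝ) :
    HasDerivAt (fun r => ∫ θ in (0 : ℝ)..(2 * π), F r θ)
      (∫ θ in (0 : ℝ)..(2 * π), F' r₀ θ) r₀ := by
  have hK : IsCompact (Set.Icc (r₀ - 1) (r₀ + 1) ×ˢ Set.uIcc (0 : ℝ) (2 * π)) :=
    isCompact_Icc.prod isCompact_uIcc
  obtain ⟨C, hC⟩ := hK.exists_bound_of_continuousOn hF'.continuousOn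
  have c1 : ∀ r, Continuous (F r) := fun r => hF.comp (by fun_prop : Continuous fun θ => (r, θ))
  have c2 : ∀ r, Continuous (F' r) := fun r => hF'.comp (by fun_prop : Continuous fun θ => (r, θ))
  refine (intervalIntegral.hasDerivAt_integral_of_dominated_loc_of_deriv_le
    (s := Set.Icc (r₀ - 1) (r₀ + 1)) (bound := fun _ => C)
    (Icc_mem_nhds (by linarith) (by linarith)) ?_ ?_ ?_ ?_ ?_ ?_).2
  · exact Eventually.of_forall fun r => (c1 r).aestronglyMeasurable
  · exact (c1 r₀).intervalIntegrable _ _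
  · exact (c2 r₀).aestronglyMeasurable
  · refine Eventually.of_forall fun θ hθ r hr => hC (r, θ) ⟨hr, Set.uIoc_subset_uIcc hθ⟩
  · exact intervalIntegrable_const
  · exact Eventually.of_forall fun θ _ r _ => hd r θ

/-- derivative of the circular means -/
lemma ns_mean_deriv {f : ℂ → ℝ} (hf : ContDiff ℝ 1 f) (z : ℂ) (r : ℝ) :
    HasDerivAt (fun r => ∫ θ in (0 : ℝ)..(2 * π), f (nsP z r θ))
      (∫ θ in (0 : ℝ)..(2 * π),
        (cos θ * nsDx f (nsP z r θ) + sin θ * nsDy f (nsP z r θ))) r := by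
  have hc := hf.continuous
  have h1 := nsDx_cont hf
  have h2 := nsDy_cont hf
  have hP := nsP_cont z
  exact ns_param (fun r θ => f (nsP z r θ)) _ (by fun_prop) (by fun_prop)
    (fun r θ => ns_deriv_r hf z r θ) r

lemma ns_int_tangential {f : ℂ → ℝ} (hf : ContDiff ℝ 1 f) (z : ℂ) {r : ℝ} (hr : r ≠ 0) :
    ∫ θ in (0 : ℝ)..(2 * π),
      (cos θ * nsDy f (nsP z r θ) - sin θ * nsDx f (nsP z r θ)) = 0 := by
  have h1 := nsDx_cont hf
  have h2 := nsDy_cont hf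
  have hP := nsP_cont_right z r
  have h := intervalIntegral.integral_eq_sub_of_hasDerivAt (a := 0) (b := 2 * π)
    (fun θ _ => ns_deriv_θ hf z r θ)
    (Continuous.intervalIntegrable (by fun_prop) _ _)
  rw [nsP_period, sub_self, intervalIntegral.integral_const_mul] at h
  exact (mul_eq_zero.mp h).resolve_left hr

/-- divergence theorem on discs in differential form -/
lemma ns_flux_deriv {α β : ℂ → ℝ} (hα : ContDiff ℝ 1 α) (hβ : ContDiff ℝ 1 β) (z : ℂ) (r : ℝ) :
    HasDerivAt (fun r => r * ∫ θ in (0 : ℝ)..(2 * π),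
        (cos θ * α (nsP z r θ) + sin θ * β (nsP z r θ)))
      (r * ∫ θ in (0 : ℝ)..(2 * π), (nsDx α (nsP z r θ) + nsDy β (nsP z r θ))) r := by
  have hαc := hα.continuous
  have hβc := hβ.continuous
  have a1 := nsDx_cont hα
  have a2 := nsDy_cont hα
  have b1 := nsDx_cont hβ
  have b2 := nsDy_cont hβ
  have hP := nsP_cont z
  have hQ := nsP_cont_right z r
  have key := ns_param (fun r θ => cos θ * α (nsP z r θ) + sin θ * β (nsP z r θ))
    (fun r θ => cos θ * (cos θ * nsDx α (nsP z r θ) + sin θ * nsDy α (nsP z r θ)) +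
      sin θ * (cos θ * nsDx β (nsP z r θ) + sin θ * nsDy β (nsP z r θ)))
    (by fun_prop) (by fun_prop)
    (fun r θ => ((ns_deriv_r hα z r θ).const_mul _).add ((ns_deriv_r hβ z r θ).const_mul _)) r
  have h3 := (hasDerivAt_id r).mul key
  have h0 := intervalIntegral.integral_eq_sub_of_hasDerivAt (a := 0) (b := 2 * π)
    (f := fun θ => sin θ * α (nsP z r θ) - cos θ * β (nsP z r θ))
    (fun θ _ => ((hasDerivAt_sin θ).mul (ns_deriv_θ hα z r θ)).sub
      ((hasDerivAt_cos θ).mul (ns_deriv_θ hβ z r θ)))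
    (Continuous.intervalIntegrable (by fun_prop) _ _)
  simp only [nsP_period, sin_two_pi, cos_two_pi, sin_zero, cos_zero, sub_self] at h0
  refine h3.congr_deriv ?_
  simp only [id, one_mul]
  rw [← sub_eq_zero, ← intervalIntegral.integral_const_mul,
    ← intervalIntegral.integral_const_mul, ← intervalIntegral.integral_add,
    ← intervalIntegral.integral_sub]
  · refine Eq.trans ?_ h0
    apply intervalIntegral.integral_congr
    intro θ _
    have hs : sin θ ^ 2 = 1 - cos θ ^ 2 := by rw [← sin_sq_add_cos_sq θ]; ring
    dsimp only
    ring_nf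
    rw [hs]
    ring
  all_goals exact Continuous.intervalIntegrable (by fun_prop) _ _

/-- The scalar situation: `w` is a vorticity-like function transported by `(a,b)`. -/
structure NsHyp (ν K : ℝ) (a b w α β : ℂ → ℝ) : Prop where
  hν : 0 < ν
  hK : 0 < K
  ha : ContDiff ℝ 1 a
  hb : ContDiff ℝ 1 b
  hw : ContDiff ℝ 1 w
  hα : ContDiff ℝ 1 α
  hβ : ContDiff ℝ 1 β
  hdiv : ∀ z, nsDx a z + nsDy b z = 0
  hrot : ∀ z, nsDx α z + nsDy β z = w z
  hab : ∀ z θ, |cos θ * a z + sin θ * b z| ≤ K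
  hαβ : ∀ z θ, |cos θ * α z + sin θ * β z| ≤ K
  hflux : ∀ z r, 0 < r → ν * (∫ θ in (0 : ℝ)..(2 * π),
      (cos θ * nsDx w (nsP z r θ) + sin θ * nsDy w (nsP z r θ))) =
    ∫ θ in (0 : ℝ)..(2 * π),
      (cos θ * a (nsP z r θ) + sin θ * b (nsP z r θ)) * w (nsP z r θ)

lemma nsDx_neg (f : ℂ → ℝ) (z : ℂ) : nsDx (fun z => - f z) z = - nsDx f z := by
  simp [nsDx, fderiv_fun_neg]

lemma nsDy_neg (f : ℂ → ℝ) (z : ℂ) : nsDy (fun z => - f z) z = - nsDy f z := by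
  simp [nsDy, fderiv_fun_neg]

lemma NsHyp.neg {ν K : ℝ} {a b w α β : ℂ → ℝ} (h : NsHyp ν K a b w α β) :
    NsHyp ν K a b (fun z => - w z) (fun z => - α z) (fun z => - β z) where
  hν := h.hν
  hK := h.hK
  ha := h.ha
  hb := h.hb
  hw := h.hw.neg
  hα := h.hα.neg
  hβ := h.hβ.neg
  hdiv := h.hdiv
  hrot z := by rw [nsDx_neg, nsDy_neg, ← h.hrot z]; ring
  hab := h.hab
  hαβ z θ := by
    have := h.hαβ z θ
    rw [← abs_neg] at this
    convert this using 2
    ring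
  hflux z r hr := by
    have := h.hflux z r hr
    simp only [nsDx_neg, nsDy_neg, mul_neg, ← neg_add, intervalIntegral.integral_neg]
    rw [this]

lemma ns_flux_zero {a b : ℂ → ℝ} (ha : ContDiff ℝ 1 a) (hb : ContDiff ℝ 1 b)
    (hdiv : ∀ z, nsDx a z + nsDy b z = 0) (z : ℂ) {r : ℝ} (hr : r ≠ 0) :
    ∫ θ in (0 : ℝ)..(2 * π), (cos θ * a (nsP z r θ) + sin θ * b (nsP z r θ)) = 0 := by
  have hd : ∀ r, HasDerivAt (fun r => r * ∫ θ in (0 : ℝ)..(2 * π),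
        (cos θ * a (nsP z r θ) + sin θ * b (nsP z r θ))) 0 r := by
    intro r
    have := ns_flux_deriv ha hb z r
    simpa [hdiv] using this
  have := is_const_of_deriv_eq_zero (fun r => (hd r).differentiableAt) (fun r => (hd r).deriv) r 0
  simp only [zero_mul] at this
  exact (mul_eq_zero.mp this).resolve_left hr

lemma ns_circ_bound {ν K : ℝ} {a b w α β : ℂ → ℝ} (h : NsHyp ν K a b w α β) (z : ℂ)
    {R μ : ℝ} (hR : 0 < R)
    (hm : ∀ r, 0 < r → r < R → 2 * π * μ ≤ ∫ θ in (0 : ℝ)..(2 * π), w (nsP z r θ)) :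
    μ * R ≤ 2 * K := by
  set C : ℝ → ℝ := fun r => r * ∫ θ in (0 : ℝ)..(2 * π),
        (cos θ * α (nsP z r θ) + sin θ * β (nsP z r θ)) with hC
  have hd : ∀ r, HasDerivAt C (r * ∫ θ in (0 : ℝ)..(2 * π), w (nsP z r θ)) r := by
    intro r
    have := ns_flux_deriv h.hα h.hβ z r
    simpa only [h.hrot] using this
  have hd2 : ∀ r, HasDerivAt (fun r => C r - π * μ * r ^ 2)
      (r * (∫ θ in (0 : ℝ)..(2 * π), w (nsP z r θ)) - π * μ * (2 * r)) r := by
    intro r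
    have := (hd r).sub ((hasDerivAt_pow 2 r).const_mul (π * μ))
    refine this.congr_deriv ?_
    simp
  have mono : MonotoneOn (fun r => C r - π * μ * r ^ 2) (Set.Icc 0 R) := by
    apply monotoneOn_of_deriv_nonneg (convex_Icc 0 R)
    · exact fun r _ => (hd2 r).continuousAt.continuousWithinAt
    · exact fun r _ => (hd2 r).differentiableAt.differentiableWithinAt
    · intro r hr
      rw [interior_Icc] at hr
      rw [(hd2 r).deriv]
      have := mul_le_mul_of_nonneg_left (hm r hr.1 hr.2) hr.1.le
      linarith
  have h1 := mono (Set.left_mem_Icc.2 hR.le) (Set.right_mem_Icc.2 hR.le) hR.le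
  have h2 : ‖∫ θ in (0 : ℝ)..(2 * π),
        (cos θ * α (nsP z R θ) + sin θ * β (nsP z R θ))‖ ≤ K * |2 * π - 0| :=
    intervalIntegral.norm_integral_le_of_norm_le_const fun θ _ => h.hαβ _ _
  rw [sub_zero, abs_of_pos two_pi_pos] at h2
  have h3 := (le_abs_self _).trans h2
  have h4 : C 0 = 0 := by simp [hC]
  have h5 : C R ≤ R * (K * (2 * π)) := mul_le_mul_of_nonneg_left h3 hR.le
  simp only [h4] at h1
  have h6 : (R * π) * (μ * R) ≤ (R * π) * (2 * K) := by nlinarith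
  exact le_of_mul_le_mul_left h6 (mul_pos hR pi_pos)

lemma ns_local {ν K : ℝ} {a b w α β : ℂ → ℝ} (h : NsHyp ν K a b w α β) (z : ℂ)
    {R A : ℝ} (hR : 0 < R) (hA : ∀ y, dist y z ≤ R → |w y| ≤ A) :
    w z * R ≤ 2 * K + K * A / ν * R * R := by
  have hA0 : 0 ≤ A := (abs_nonneg _).trans (hA z (by simpa using hR.le))
  set D := K * A / ν with hD
  set m : ℝ → ℝ := fun r => ∫ θ in (0 : ℝ)..(2 * π), w (nsP z r θ) with hmdef
  have hd := ns_mean_deriv h.hw z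
  have hd2 : ∀ r, HasDerivAt (fun r => m r + 2 * π * D * r) (_ + 2 * π * D) r := fun r =>
    (hd r).add (by simpa using (hasDerivAt_id r).const_mul (2 * π * D))
  have mono : MonotoneOn (fun r => m r + 2 * π * D * r) (Set.Icc 0 R) := by
    apply monotoneOn_of_deriv_nonneg (convex_Icc 0 R)
    · exact fun r _ => (hd2 r).continuousAt.continuousWithinAt
    · exact fun r _ => (hd2 r).differentiableAt.differentiableWithinAt
    · intro r hr
      rw [interior_Icc] at hr
      rw [(hd2 r).deriv]
      have h2 : ‖∫ θ in (0 : ℝ)..(2 * π),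
        (cos θ * a (nsP z r θ) + sin θ * b (nsP z r θ)) * w (nsP z r θ)‖
          ≤ K * A * |2 * π - 0| := by
        refine intervalIntegral.norm_integral_le_of_norm_le_const fun θ _ => ?_
        rw [norm_mul]
        exact mul_le_mul (h.hab _ _) (hA _ (by rw [nsP_dist z hr.1.le]; exact hr.2.le))
          (norm_nonneg _) h.hK.le
      rw [sub_zero, abs_of_pos two_pi_pos, ← h.hflux z r hr.1] at h2
      have h3 := (abs_le.mp h2).1
      have h4 : ν * D = K * A := by rw [hD]; field_simp [h.hν.ne']
      refine nonneg_of_mul_nonneg_right (a := ν) ?_ h.hν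
      rw [mul_add]
      have : ν * (2 * π * D) = K * A * (2 * π) := by rw [← h4]; ring
      linarith
  have hm0 : m 0 = 2 * π * w z := by simp [hmdef, nsP_zero]
  have hD0 : 0 ≤ D := div_nonneg (mul_nonneg h.hK.le hA0) h.hν.le
  have := ns_circ_bound h z (μ := w z - D * R) hR (by
    intro r hr hrR
    have h1 := mono (Set.left_mem_Icc.2 hR.le) (⟨hr.le, hrR.le⟩ : r ∈ Set.Icc 0 R) hr.le
    simp only [hm0] at h1
    have h2 : 2 * π * D * r ≤ 2 * π * D * R :=
      mul_le_mul_of_nonneg_left hrR.le (by positivity)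
    change _ ≤ m r
    linarith)
  linarith

lemma ns_bounded {ν K : ℝ} {a b w α β : ℂ → ℝ} (h : NsHyp ν K a b w α β) :
    ∃ B, ∀ z, w z ≤ B := by
  have hν := h.hν
  have hK := h.hK
  set t := min (1 / 2) (ν / (4 * K)) with ht
  have ht0 : 0 < t := lt_min (by norm_num) (by positivity)
  have ht1 : t ≤ 1 / 2 := min_le_left _ _
  have ht2 : t * (4 * K) ≤ ν := (le_div_iff₀ (by positivity)).1 (min_le_right _ _)
  refine ⟨4 * K / t, fun y => ?_⟩
  have hwc := h.hw.continuous
  obtain ⟨x, hx, hmax⟩ := (isCompact_closedBall y (1 : ℝ)).exists_isMaxOn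
    ⟨y, by simp⟩ (f := fun z => (1 - dist z y) * |w z|)
    (Continuous.continuousOn (by fun_prop))
  set N := (1 - dist x y) * |w x| with hN
  have hmax' : ∀ z, dist z y ≤ 1 → (1 - dist z y) * |w z| ≤ N := fun z hz => hmax hz
  have hyN : |w y| ≤ N := by simpa using hmax' y (by simp)
  refine (le_abs_self _).trans (hyN.trans ?_)
  have hB : 0 < 4 * K / t := by positivity
  rcases (mem_closedBall_iff_norm.1 hx).eq_or_lt with he | hlt
  · rw [← dist_eq_norm] at he
    rw [hN, he]; simpa using hB.le
  rw [← dist_eq_norm] at hlt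
  set d := 1 - dist x y with hd
  have hd0 : 0 < d := by linarith
  have hd1 : d ≤ 1 := by have := dist_nonneg (x := x) (y := y); linarith
  have hN0 : 0 ≤ N := mul_nonneg hd0.le (abs_nonneg _)
  have hloc : ∀ z, dist z x ≤ t * d → |w z| ≤ 2 * N / d := by
    intro z hz
    have h1 := dist_triangle z x y
    have h2 : t * d ≤ d / 2 := by nlinarith
    have h3 := hmax' z (by linarith)
    rw [le_div_iff₀ hd0]
    have h4 : d / 2 * |w z| ≤ (1 - dist z y) * |w z| :=
      mul_le_mul_of_nonneg_right (by linarith) (abs_nonneg _)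
    linarith
  have hR : 0 < t * d := by positivity
  have e1 := ns_local h x hR hloc
  have e2 := ns_local h.neg x hR (by simpa only [abs_neg] using hloc)
  have e3 : |w x| * (t * d) ≤ 2 * K + K * (2 * N / d) / ν * (t * d) * (t * d) := by
    rcases abs_choice (w x) with hh | hh <;> rw [hh] <;> assumption
  have e4 : K * (2 * N / d) / ν * (t * d) * (t * d) ≤ N * t / 2 := by
    have : K * (2 * N / d) / ν * (t * d) * (t * d) = (t * (4 * K)) / ν * d * (N * t / 2) := by
      field_simp
      ring
    rw [this]
    have h1 : (t * (4 * K)) / ν ≤ 1 := (div_le_one hν).2 ht2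
    have h2 : (t * (4 * K)) / ν * d ≤ 1 := mul_le_one₀ h1 hd0.le hd1
    exact mul_le_of_le_one_left (by positivity) h2
  have e5 : |w x| * (t * d) = N * t := by rw [hN]; ring
  rw [le_div_iff₀ ht0]
  linarith

lemma ns_nonpos {ν K : ℝ} {a b w α β : ℂ → ℝ} (h : NsHyp ν K a b w α β) (z : ℂ) :
    w z ≤ 0 := by
  by_contra! hpos
  have hν := h.hν
  have hK := h.hK
  obtain ⟨B, hB⟩ := ns_bounded h
  have hbdd : BddAbove (Set.range w) := ⟨B, by rintro _ ⟨y, rfl⟩; exact hB y⟩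
  set M := sSup (Set.range w) with hM
  have hle : ∀ y, w y ≤ M := fun y => le_csSup hbdd ⟨y, rfl⟩
  have hM0 : 0 < M := hpos.trans_le (hle z)
  set R := (4 * K + 4) / M with hRdef
  have hR : 0 < R := by positivity
  set k := K / ν with hk
  have hk0 : 0 < k := by positivity
  obtain ⟨_, ⟨x, rfl⟩, hx⟩ := exists_lt_of_lt_csSup (Set.range_nonempty w)
    (show M - M / 2 * exp (-(k * R)) < M from sub_lt_self _ (by positivity))
  -- spherical means of `M - w`
  set g : ℝ → ℝ := fun r => ∫ θ in (0 : ℝ)..(2 * π), (M - w (nsP x r θ)) with hg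
  have hac := h.ha.continuous
  have hbc := h.hb.continuous
  have hwc := h.hw.continuous
  have hgm : ∀ r, g r = 2 * π * M - ∫ θ in (0 : ℝ)..(2 * π), w (nsP x r θ) := by
    intro r
    have hQ := nsP_cont_right x r
    simp only [hg]
    rw [intervalIntegral.integral_sub]
    · simp
    all_goals exact Continuous.intervalIntegrable (by fun_prop) _ _
  have hgd : ∀ r, HasDerivAt g (-(∫ θ in (0 : ℝ)..(2 * π),
        (cos θ * nsDx w (nsP x r θ) + sin θ * nsDy w (nsP x r θ)))) r := by
    intro r
    rw [funext hgm]
    exact (ns_mean_deriv h.hw x r).const_sub _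
  have hgron : ∀ r, 0 < r → -(∫ θ in (0 : ℝ)..(2 * π),
        (cos θ * nsDx w (nsP x r θ) + sin θ * nsDy w (nsP x r θ))) ≤ k * g r := by
    intro r hr
    have hQ := nsP_cont_right x r
    have f0 := ns_flux_zero h.ha h.hb h.hdiv x hr.ne'
    have f1 := h.hflux x r hr
    have f2 : ∫ θ in (0 : ℝ)..(2 * π),
        (cos θ * a (nsP x r θ) + sin θ * b (nsP x r θ)) * (M - w (nsP x r θ)) =
        M * (∫ θ in (0 : ℝ)..(2 * π), (cos θ * a (nsP x r θ) + sin θ * b (nsP x r θ))) -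
        ∫ θ in (0 : ℝ)..(2 * π),
          (cos θ * a (nsP x r θ) + sin θ * b (nsP x r θ)) * w (nsP x r θ) := by
      rw [← intervalIntegral.integral_const_mul, ← intervalIntegral.integral_sub]
      · apply intervalIntegral.integral_congr
        intro θ _
        ring
      all_goals exact Continuous.intervalIntegrable (by fun_prop) _ _
    have f3 : ∫ θ in (0 : ℝ)..(2 * π),
        (cos θ * a (nsP x r θ) + sin θ * b (nsP x r θ)) * (M - w (nsP x r θ)) ≤ K * g r := by
      simp only [hg]
      rw [← intervalIntegral.integral_const_mul]
      apply intervalIntegral.integral_mono_on two_pi_pos.le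
      · exact Continuous.intervalIntegrable (by fun_prop) _ _
      · exact Continuous.intervalIntegrable (by fun_prop) _ _
      · intro θ _
        exact mul_le_mul_of_nonneg_right ((le_abs_self _).trans (h.hab _ _))
          (by linarith [hle (nsP x r θ)])
    rw [f2, f0, ← f1] at f3
    have : k * g r = K * g r / ν := by rw [hk]; ring
    rw [this, le_div_iff₀ hν]
    linarith
  have hGd : ∀ r, HasDerivAt (fun r => g r * exp (-(k * r))) (_ * _ + g r * (exp (-(k * r)) * (-k))) r :=
    fun r => (hgd r).mul (by simpa using (((hasDerivAt_id r).const_mul k).neg).exp)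
  have anti : AntitoneOn (fun r => g r * exp (-(k * r))) (Set.Icc 0 R) := by
    apply antitoneOn_of_deriv_nonpos (convex_Icc 0 R)
    · exact fun r _ => (hGd r).continuousAt.continuousWithinAt
    · exact fun r _ => (hGd r).differentiableAt.differentiableWithinAt
    · intro r hr
      rw [interior_Icc] at hr
      rw [(hGd r).deriv]
      have := mul_le_mul_of_nonneg_right (hgron r hr.1) (exp_pos (-(k * r))).le
      linarith
  have hg0 : g 0 = 2 * π * (M - w x) := by
    simp [hg, nsP_zero]
    ring
  have := ns_circ_bound h x (μ := M / 2) hR (by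
    intro r hr hrR
    have h1 := anti (Set.left_mem_Icc.2 hR.le) (⟨hr.le, hrR.le⟩ : r ∈ Set.Icc 0 R) hr.le
    simp only [hg0, mul_zero, neg_zero, exp_zero, mul_one] at h1
    have h2 : exp (-(k * R)) ≤ exp (-(k * r)) :=
      exp_le_exp.2 (neg_le_neg (mul_le_mul_of_nonneg_left hrR.le hk0.le))
    have h3 : M - w x ≤ M / 2 * exp (-(k * r)) := by
      have := mul_le_mul_of_nonneg_left h2 (by positivity : 0 ≤ M / 2)
      linarith
    have h4 : g r * exp (-(k * r)) ≤ (2 * π * (M / 2)) * exp (-(k * r)) := by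
      refine h1.trans ?_
      have := mul_le_mul_of_nonneg_left h3 two_pi_pos.le
      linarith
    have h5 := le_of_mul_le_mul_right h4 (exp_pos _)
    have h6 := hgm r
    linarith)
  have hRM : M * R = 4 * K + 4 := by rw [hRdef]; field_simp
  linarith

lemma ns_vort_zero {ν K : ℝ} {a b w α β : ℂ → ℝ} (h : NsHyp ν K a b w α β) (z : ℂ) :
    w z = 0 := by
  have h1 := ns_nonpos h z
  have h2 := ns_nonpos h.neg z
  linarith

/-! ### From the Navier-Stokes system to the scalar situation -/

lemma nsDx_contDiff {f : ℂ → ℝ} (hf : ContDiff ℝ 2 f) : ContDiff ℝ 1 (nsDx f) := by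
  unfold nsDx
  exact (hf.fderiv_right (m := 1) (by norm_num)).clm_apply contDiff_const

lemma nsDy_contDiff {f : ℂ → ℝ} (hf : ContDiff ℝ 2 f) : ContDiff ℝ 1 (nsDy f) := by
  unfold nsDy
  exact (hf.fderiv_right (m := 1) (by norm_num)).clm_apply contDiff_const

lemma ns_symm {f : ℂ → ℝ} (hf : ContDiff ℝ 2 f) (z : ℂ) :
    nsDx (nsDy f) z = nsDy (nsDx f) z := by
  have hd : DifferentiableAt ℝ (fderiv ℝ f) z :=
    (hf.fderiv_right (m := 1) (by norm_num)).differentiable (by norm_num) z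
  have hs : IsSymmSndFDerivAt ℝ f z := hf.contDiffAt.isSymmSndFDerivAt (by simp)
  have h1 : ∀ v : ℂ, fderiv ℝ (fun y => fderiv ℝ f y v) z = (fderiv ℝ (fderiv ℝ f) z).flip v := by
    intro v
    rw [fderiv_clm_apply hd (differentiableAt_const v)]
    simp
  change fderiv ℝ (fun y => fderiv ℝ f y Complex.I) z 1 = fderiv ℝ (fun y => fderiv ℝ f y 1) z Complex.I
  rw [h1, h1]
  exact hs 1 Complex.I

lemma ns_mk {ν K : ℝ} (hν : 0 < ν) (hK : 0 < K) {a b p : ℂ → ℝ} (ha : ContDiff ℝ 2 a)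
    (hb : ContDiff ℝ 2 b) (hp : ContDiff ℝ 1 p)
    (h1 : ∀ z, -ν * (nsDx (nsDx a) z + nsDy (nsDy a) z) + (a z * nsDx a z + b z * nsDy a z)
      + nsDx p z = 0)
    (h2 : ∀ z, -ν * (nsDx (nsDx b) z + nsDy (nsDy b) z) + (a z * nsDx b z + b z * nsDy b z)
      + nsDy p z = 0)
    (hdiv : ∀ z, nsDx a z + nsDy b z = 0) (hab : ∀ z, a z ^ 2 + b z ^ 2 ≤ K ^ 2) :
    NsHyp ν K a b (fun z => nsDx b z - nsDy a z) b (fun z => - a z) := by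
  have ha1 : ContDiff ℝ 1 a := ha.of_le (by norm_num)
  have hb1 : ContDiff ℝ 1 b := hb.of_le (by norm_num)
  have hax := nsDx_contDiff ha
  have hay := nsDy_contDiff ha
  have hbx := nsDx_contDiff hb
  have hby := nsDy_contDiff hb
  have one_ne : (1 : WithTop ℕ∞) ≠ 0 := by norm_num
  have hw : ContDiff ℝ 1 (fun z => nsDx b z - nsDy a z) := hbx.sub hay
  have hax_eq : nsDx a = fun z => - nsDy b z := funext fun z => by linarith [hdiv z]
  have hby_eq : nsDy b = fun z => - nsDx a z := funext fun z => by linarith [hdiv z]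
  have wx : ∀ z, nsDx (fun z => nsDx b z - nsDy a z) z = nsDx (nsDx b) z - nsDx (nsDy a) z := by
    intro z
    rw [nsDx]
    rw [fderiv_fun_sub (hbx.differentiable one_ne z) (hay.differentiable one_ne z)]
    rfl
  have wy : ∀ z, nsDy (fun z => nsDx b z - nsDy a z) z = nsDy (nsDx b) z - nsDy (nsDy a) z := by
    intro z
    rw [nsDy]
    rw [fderiv_fun_sub (hbx.differentiable one_ne z) (hay.differentiable one_ne z)]
    rfl
  have q1 : ∀ z, nsDx (nsDy a) z = - nsDy (nsDy b) z := by
    intro z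
    rw [ns_symm ha, hax_eq, nsDy_neg]
  have q2 : ∀ z, nsDy (nsDx b) z = - nsDx (nsDx a) z := by
    intro z
    rw [← ns_symm hb, hby_eq, nsDx_neg]
  set Φ : ℂ → ℝ := fun z => p z + (a z * a z + b z * b z) / 2 with hΦ
  have hΦc : ContDiff ℝ 1 Φ := hp.add (((ha1.mul ha1).add (hb1.mul hb1)).div_const 2)
  have dΦ : ∀ z v, fderiv ℝ Φ z v = fderiv ℝ p z v + (a z * fderiv ℝ a z v + b z * fderiv ℝ b z v) := by
    intro z v
    have da := (ha1.differentiable one_ne z).hasFDerivAt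
    have db := (hb1.differentiable one_ne z).hasFDerivAt
    have dp := (hp.differentiable one_ne z).hasFDerivAt
    have hh := dp.add (((da.mul da).add (db.mul db)).mul_const (1 / 2 : ℝ))
    have e : Φ = p + (fun y => (a * a + b * b) y * (1 / 2 : ℝ)) := by
      funext y
      simp [hΦ]
      ring
    rw [e, hh.fderiv]
    simp
    ring
  have tri : ∀ (x y θ : ℝ), x ^ 2 + y ^ 2 ≤ K ^ 2 → |cos θ * x + sin θ * y| ≤ K := by
    intro x y θ hxy
    apply abs_le_of_sq_le_sq _ hK.le
    refine le_trans ?_ hxy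
    have hs := sin_sq_add_cos_sq θ
    have : x ^ 2 + y ^ 2 = (cos θ * x + sin θ * y) ^ 2 + (sin θ * x - cos θ * y) ^ 2 := by
      calc x ^ 2 + y ^ 2 = (x ^ 2 + y ^ 2) * (sin θ ^ 2 + cos θ ^ 2) := by rw [hs, mul_one]
        _ = _ := by ring
    rw [this]
    linarith [sq_nonneg (sin θ * x - cos θ * y)]
  refine ⟨hν, hK, ha1, hb1, hw, hb1, ha1.neg, hdiv, ?_, fun z θ => tri _ _ _ (hab z), ?_, ?_⟩
  · intro z
    rw [nsDy_neg]
    ring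
  · intro z θ
    apply tri
    have := hab z
    nlinarith
  · intro z r hr
    have t := ns_int_tangential hΦc z hr.ne'
    rw [← sub_eq_zero, ← intervalIntegral.integral_const_mul, ← intervalIntegral.integral_sub]
    · refine Eq.trans ?_ t
      apply intervalIntegral.integral_congr
      intro θ _
      dsimp only
      generalize nsP z r θ = y
      have e1 := h1 y
      have e2 := h2 y
      have e3 := dΦ y 1
      have e4 := dΦ y Complex.I
      have e5 := wx y
      have e6 := wy y
      rw [q1] at e5
      rw [q2] at e6
      change nsDx Φ y = nsDx p y + (a y * nsDx a y + b y * nsDx b y) at e3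
      change nsDy Φ y = nsDy p y + (a y * nsDy a y + b y * nsDy b y) at e4
      rw [e5, e6, e3, e4]
      linear_combination (-cos θ) * e2 + sin θ * e1
    · have c1 := nsDx_cont hw
      have c2 := nsDy_cont hw
      have c3 := nsP_cont_right z r
      exact Continuous.intervalIntegrable (by fun_prop) _ _
    · have c1 := ha.continuous
      have c2 := hb.continuous
      have c3 := nsP_cont_right z r
      have c4 := hw.continuous
      exact Continuous.intervalIntegrable (by fun_prop) _ _

lemma ns_const {a b : ℂ → ℝ} (ha : ContDiff ℝ 1 a) (hb : ContDiff ℝ 1 b) {K : ℝ} (hK : 0 < K)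
    (hdiv : ∀ z, nsDx a z + nsDy b z = 0) (hrot : ∀ z, nsDx b z - nsDy a z = 0)
    (hab : ∀ z, a z ^ 2 + b z ^ 2 ≤ K ^ 2) (z : ℂ) : a z = a 0 ∧ b z = b 0 := by
  have one_ne : (1 : WithTop ℕ∞) ≠ 0 := by norm_num
  set f : ℂ → ℂ := fun z => (a z : ℂ) - (b z : ℂ) * Complex.I with hf
  have hd : ∀ z, HasFDerivAt f (Complex.ofRealCLM.comp (fderiv ℝ a z) -
      (Complex.ofRealCLM.comp (fderiv ℝ b z)).smulRight Complex.I) z := by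
    intro z
    have da := (ha.differentiable one_ne z).hasFDerivAt
    have db := (hb.differentiable one_ne z).hasFDerivAt
    have da' := Complex.ofRealCLM.hasFDerivAt.comp z da
    have db' := Complex.ofRealCLM.hasFDerivAt.comp z db
    have := da'.sub (db'.mul_const' Complex.I)
    refine this.congr_fderiv ?_
    ext v
    simp [mul_comm]
  have hdf : Differentiable ℂ f := by
    intro z
    rw [differentiableAt_complex_iff_differentiableAt_real]
    refine ⟨(hd z).differentiableAt, ?_⟩
    rw [(hd z).fderiv]
    have e1 := hdiv z
    have e2 := hrot z
    simp only [nsDx, nsDy] at e1 e2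
    apply Complex.ext
    · simp
      linarith
    · simp
      linarith
  have hbd : Bornology.IsBounded (Set.range f) := by
    rw [isBounded_iff_forall_norm_le]
    refine ⟨K, ?_⟩
    rintro _ ⟨y, rfl⟩
    refine (sq_le_sq₀ (norm_nonneg _) hK.le).1 ?_
    rw [← Complex.normSq_eq_norm_sq, Complex.normSq_apply]
    have := hab y
    simp [hf]
    nlinarith
  have := hdf.apply_eq_apply_of_bounded hbd z 0
  have h1 := congrArg Complex.re this
  have h2 := congrArg Complex.im this
  simp [hf] at h1 h2
  exact ⟨h1, h2⟩

/-- The identification of the complex plane with the Euclidean plane. -/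
def nsL : ℂ →L[ℝ] EuclideanSpace ℝ (Fin 2) :=
  Complex.reCLM.smulRight (EuclideanSpace.single 0 1) +
    Complex.imCLM.smulRight (EuclideanSpace.single 1 1)

lemma nsL_one : nsL 1 = EuclideanSpace.single 0 1 := by
  simp [nsL]

lemma nsL_I : nsL Complex.I = EuclideanSpace.single 1 1 := by
  simp [nsL]

lemma nsL_surj (x : EuclideanSpace ℝ (Fin 2)) : nsL ⟨x 0, x 1⟩ = x := by
  ext i
  fin_cases i <;> simp [nsL]

lemma nsL_fderiv {U : EuclideanSpace ℝ (Fin 2) → EuclideanSpace ℝ (Fin 2)}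
    (hU : Differentiable ℝ U) (i : Fin 2) (z v : ℂ) :
    fderiv ℝ (fun z => U (nsL z) i) z v = fderiv ℝ U (nsL z) (nsL v) i := by
  have h1 := (hU (nsL z)).hasFDerivAt.comp z nsL.hasFDerivAt
  have h2 := (EuclideanSpace.proj i : EuclideanSpace ℝ (Fin 2) →L[ℝ] ℝ).hasFDerivAt.comp z h1
  have h3 : HasFDerivAt (fun z => U (nsL z) i) _ z := h2
  rw [h3.fderiv]
  rfl

lemma nsL_dx {U : EuclideanSpace ℝ (Fin 2) → EuclideanSpace ℝ (Fin 2)}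
    (hU : Differentiable ℝ U) (i : Fin 2) :
    nsDx (fun z => U (nsL z) i) = fun z => pd U 0 (nsL z) i := by
  funext z
  rw [nsDx, nsL_fderiv hU, nsL_one, pd]

lemma nsL_dy {U : EuclideanSpace ℝ (Fin 2) → EuclideanSpace ℝ (Fin 2)}
    (hU : Differentiable ℝ U) (i : Fin 2) :
    nsDy (fun z => U (nsL z) i) = fun z => pd U 1 (nsL z) i := by
  funext z
  rw [nsDy, nsL_fderiv hU, nsL_I, pd]

/-- Liouville theorem for bounded solutions of the 2D stationary
Navier–Stokes system -νΔu + (u·∇)u + ∇π = 0, div u = 0. -/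
theorem liouville_navier_stokes_2d
    (ν : ℝ) (hν : 0 < ν)
    (u : EuclideanSpace ℝ (Fin 2) → EuclideanSpace ℝ (Fin 2))
    (pr : EuclideanSpace ℝ (Fin 2) → ℝ)
    (hu : ContDiff ℝ 2 u) (hpr : ContDiff ℝ 1 pr)
    (heq : ∀ x, ∀ i : Fin 2,
      -ν * (∑ k, pd (fun y => pd u k y) k x i)
        + (∑ k, u x k * pd u k x i)
        + fderiv ℝ pr x (EuclideanSpace.single i 1) = 0)
    (hdiv : ∀ x, divg u x = 0)
    (hbdd : ∃ M : ℝ, ∀ x, ‖u x‖ ≤ M) :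
    ∃ c, ∀ x, u x = c := by
  obtain ⟨M, hM⟩ := hbdd
  have one_ne : (1 : WithTop ℕ∞) ≠ 0 := by norm_num
  set K := |M| + 1 with hKdef
  have hK : 0 < K := by positivity
  have hu1 : Differentiable ℝ u := hu.differentiable (by norm_num)
  have hpdd : ∀ k, Differentiable ℝ (pd u k) := by
    intro k
    unfold pd
    exact ((hu.fderiv_right (m := 1) (by norm_num)).clm_apply contDiff_const).differentiable one_ne
  have hcomp : ∀ i : Fin 2, ContDiff ℝ 2 (fun z => u (nsL z) i) := by
    intro i
    exact (EuclideanSpace.proj i : EuclideanSpace ℝ (Fin 2) →L[ℝ] ℝ).contDiff.comp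
      (hu.comp nsL.contDiff)
  have hp : ContDiff ℝ 1 (fun z => pr (nsL z)) := hpr.comp nsL.contDiff
  have hpd : ∀ z v, fderiv ℝ (fun z => pr (nsL z)) z v = fderiv ℝ pr (nsL z) (nsL v) := by
    intro z v
    have h1 := ((hpr.differentiable one_ne) (nsL z)).hasFDerivAt.comp z nsL.hasFDerivAt
    have h3 : HasFDerivAt (fun z => pr (nsL z)) _ z := h1
    rw [h3.fderiv]
    rfl
  have hab : ∀ z, (u (nsL z) 0) ^ 2 + (u (nsL z) 1) ^ 2 ≤ K ^ 2 := by
    intro z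
    have h1 := hM (nsL z)
    have h2 : ‖u (nsL z)‖ ^ 2 = (u (nsL z) 0) ^ 2 + (u (nsL z) 1) ^ 2 := by
      rw [EuclideanSpace.norm_sq_eq, Fin.sum_univ_two]
      simp
    rw [← h2]
    have h3 : ‖u (nsL z)‖ ≤ K := by
      have := le_abs_self M
      linarith
    exact pow_le_pow_left₀ (norm_nonneg _) h3 2
  have hdiv' : ∀ z, nsDx (fun z => u (nsL z) 0) z + nsDy (fun z => u (nsL z) 1) z = 0 := by
    intro z
    rw [nsL_dx hu1, nsL_dy hu1]
    have := hdiv (nsL z)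
    rwa [divg, Fin.sum_univ_two] at this
  have H := ns_mk hν hK (hcomp 0) (hcomp 1) hp ?_ ?_ hdiv' hab
  · have hrot := ns_vort_zero H
    have hc := ns_const ((hcomp 0).of_le (by norm_num)) ((hcomp 1).of_le (by norm_num)) hK
      hdiv' hrot hab
    refine ⟨u (nsL 0), fun x => ?_⟩
    obtain ⟨h0, h1⟩ := hc ⟨x 0, x 1⟩
    rw [nsL_surj] at h0 h1
    ext i
    fin_cases i
    · exact h0
    · exact h1
  · intro z
    have h := heq (nsL z) 0
    simp only [Fin.sum_univ_two] at h
    rw [nsL_dx hu1, nsL_dy hu1, nsL_dx (hpdd 0), nsL_dy (hpdd 1), nsDx, hpd, nsL_one]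
    exact h
  · intro z
    have h := heq (nsL z) 1
    simp only [Fin.sum_univ_two] at h
    rw [nsL_dx hu1, nsL_dy hu1, nsL_dx (hpdd 0), nsL_dy (hpdd 1), nsDy, hpd, nsL_I]
    exact h
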